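/- Each of the four matrices Z1, Z2, Z3, Z4 is a modular invariant for (S,T): it commutes with both S and T, all its entries are nonnegative integers, and its (0,0) entry equals 1. -/

import Mathlib

open Matrix Complex

noncomputable section

/-- d = 1 + √3 -/
def dd : ℂ := 1 + Real.sqrt 3

/-- L = 2 + d² = 6 + 2√3 -/
def LL : ℂ := 6 + 2 * Real.sqrt 3

/-- The S-matrix of the modular data of the quantum double of the even E6 system. -/
def S : Matrix (Fin 10) (Fin 10) ℂ := LL⁻¹ •
  !![1,    1,    1+dd, 1+dd, 2+dd,  dd,   dd,    dd,          dd,          dd;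
     1,    1,    1+dd, 1+dd, -2-dd, dd,   dd,    -dd,         -dd,         -dd;
     1+dd, 1+dd, 1,    1,    2+dd,  -dd,  -dd,   -dd,         -dd,         -dd;
     1+dd, 1+dd, 1,    1,    -2-dd, -dd,  -dd,   dd,          dd,          dd;
     2+dd, -2-dd,2+dd, -2-dd,0,     0,    0,     0,           0,           0;
     dd,   dd,   -dd,  -dd,  0,     dd,   dd,    -dd,         -dd,         2*dd;
     dd,   dd,   -dd,  -dd,  0,     dd,   dd,    -dd,         -dd,         -2*dd;
     dd,   -dd,  -dd,  dd,   0,     -dd,  dd,    -(2+dd)*I,   (2+dd)*I,    0;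
     dd,   -dd,  -dd,  dd,   0,     -dd,  dd,    (2+dd)*I,    -(2+dd)*I,   0;
     dd,   -dd,  -dd,  dd,   0,     2*dd, -2*dd, 0,           0,           0]

/-- The T-matrix: diag(1,−1,1,−1,1,e^{πi/3},e^{4πi/3},e^{5πi/6},e^{5πi/6},−i). -/
def T : Matrix (Fin 10) (Fin 10) ℂ := Matrix.diagonal
  ![1, -1, 1, -1, 1,
    Complex.exp (Real.pi * I / 3), Complex.exp (4 * Real.pi * I / 3),
    Complex.exp (5 * Real.pi * I / 6), Complex.exp (5 * Real.pi * I / 6), -I]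

/-- Z1: the identity modular invariant. -/
def Z1 : Matrix (Fin 10) (Fin 10) ℂ := 1

/-- Z2: the permutation matrix of the transposition (7 8). -/
def Z2 : Matrix (Fin 10) (Fin 10) ℂ := Matrix.of fun μ ν =>
  if (μ = 7 ∧ ν = 8) ∨ (μ = 8 ∧ ν = 7) then 1
  else if μ = ν ∧ μ ≠ 7 ∧ μ ≠ 8 then 1 else 0

/-- Z3. -/
def Z3 : Matrix (Fin 10) (Fin 10) ℂ := Matrix.of fun μ ν =>
  if (μ = 0 ∨ μ = 2) ∧ (ν = 0 ∨ ν = 2) then 1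
  else if (μ = 1 ∨ μ = 3) ∧ (ν = 1 ∨ ν = 3) then 1
  else if μ = 4 ∧ ν = 4 then 2 else 0

/-- Z4. -/
def Z4 : Matrix (Fin 10) (Fin 10) ℂ := Matrix.of fun μ ν =>
  if (μ = 0 ∨ μ = 2 ∨ μ = 4) ∧ (ν = 0 ∨ ν = 2 ∨ ν = 4) then 1 else 0

theorem Z2_eq_toMatrix_swap : Z2 = (Equiv.swap (7 : Fin 10) 8).toPEquiv.toMatrix := by
  ext μ ν
  rw [Z2, Matrix.of_apply, PEquiv.toMatrix_apply, ← ite_or]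
  refine if_congr ?_ rfl rfl
  revert μ ν
  decide

theorem Z2_mul_S : Z2 * S = S * Z2 := by
  have hswap : ⇑(Equiv.swap (7 : Fin 10) 8) = ![0, 1, 2, 3, 4, 5, 6, 8, 7, 9] := by decide
  rw [S, Matrix.mul_smul, Matrix.smul_mul, Z2_eq_toMatrix_swap, PEquiv.toMatrix_toPEquiv_mul,
    PEquiv.mul_toMatrix_toPEquiv, Equiv.symm_swap, hswap]
  congr 1
  ext μ ν
  fin_cases μ <;> fin_cases ν <;> simp

theorem Z3_mul_S : Z3 * S = S * Z3 := by
  rw [S, Matrix.mul_smul, Matrix.smul_mul]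
  congr 1
  ext μ ν
  fin_cases μ <;> fin_cases ν <;>
    simp [Matrix.mul_apply, Fin.sum_univ_succ, Z3] <;> ring

theorem Z4_mul_S : Z4 * S = S * Z4 := by
  rw [S, Matrix.mul_smul, Matrix.smul_mul]
  congr 1
  ext μ ν
  fin_cases μ <;> fin_cases ν <;>
    simp [Matrix.mul_apply, Fin.sum_univ_succ, Z4] <;> ring

/-- A matrix commutes with a diagonal matrix whose entries agree wherever the matrix is nonzero. -/
theorem mul_diagonal_eq_diagonal_mul {n R : Type*} [Fintype n] [DecidableEq n] [CommSemiring R]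
    {Z : Matrix n n R} {t : n → R} (h : ∀ μ ν, Z μ ν ≠ 0 → t μ = t ν) :
    Z * Matrix.diagonal t = Matrix.diagonal t * Z := by
  ext μ ν
  rw [Matrix.mul_diagonal, Matrix.diagonal_mul, mul_comm]
  by_cases hZ : Z μ ν = 0
  · simp [hZ]
  · rw [h μ ν hZ]

theorem Z2_mul_T : Z2 * T = T * Z2 := by
  refine mul_diagonal_eq_diagonal_mul fun μ ν h => ?_
  simp only [Z2, Matrix.of_apply] at h
  split_ifs at h with h1 h2
  · rcases h1 with ⟨rfl, rfl⟩ | ⟨rfl, rfl⟩ <;> rfl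
  · rw [h2.1]
  · simp at h

theorem Z3_mul_T : Z3 * T = T * Z3 := by
  refine mul_diagonal_eq_diagonal_mul fun μ ν h => ?_
  simp only [Z3, Matrix.of_apply] at h
  split_ifs at h with h1 h2 h3
  · rcases h1 with ⟨rfl | rfl, rfl | rfl⟩ <;> rfl
  · rcases h2 with ⟨rfl | rfl, rfl | rfl⟩ <;> rfl
  · rw [h3.1, h3.2]
  · simp at h

theorem Z4_mul_T : Z4 * T = T * Z4 := by
  refine mul_diagonal_eq_diagonal_mul fun μ ν h => ?_
  simp only [Z4, Matrix.of_apply] at h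
  split_ifs at h with h1
  · rcases h1 with ⟨rfl | rfl | rfl, rfl | rfl | rfl⟩ <;> rfl
  · simp at h

/-- Each of Z1, Z2, Z3, Z4 is a modular invariant for (S,T): it commutes with S and T,
has nonnegative integer entries, and its (0,0) entry is 1. -/
theorem Z_are_modular_invariants :
    ∀ Z ∈ ({Z1, Z2, Z3, Z4} : Set (Matrix (Fin 10) (Fin 10) ℂ)),
      Z * S = S * Z ∧ Z * T = T * Z ∧
      (∀ μ ν : Fin 10, ∃ n : ℕ, Z μ ν = (n : ℂ)) ∧ Z 0 0 = 1 := by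
  rintro Z (rfl | rfl | rfl | rfl)
  · refine ⟨by simp [Z1], by simp [Z1], fun μ ν => ?_, by simp [Z1]⟩
    rw [Z1, Matrix.one_apply]
    exact ⟨if μ = ν then 1 else 0, by push_cast; rfl⟩
  · refine ⟨Z2_mul_S, Z2_mul_T, fun μ ν => ?_, by simp [Z2]⟩
    simp only [Z2, Matrix.of_apply]
    split_ifs
    exacts [⟨1, by simp⟩, ⟨1, by simp⟩, ⟨0, by simp⟩]
  · refine ⟨Z3_mul_S, Z3_mul_T, fun μ ν => ?_, by simp [Z3]⟩
    simp only [Z3, Matrix.of_apply]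
    split_ifs
    exacts [⟨1, by simp⟩, ⟨1, by simp⟩, ⟨2, by simp⟩, ⟨0, by simp⟩]
  · refine ⟨Z4_mul_S, Z4_mul_T, fun μ ν => ?_, by simp [Z4]⟩
    simp only [Z4, Matrix.of_apply]
    split_ifs
    exacts [⟨1, by simp⟩, ⟨0, by simp⟩]
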